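/- Let M : ℝ → Matrix (Fin 2) (Fin 2) ℝ be a family of 2×2 real matrices whose entries are differentiable at b₀, and let λ : ℝ → ℝ be differentiable at b₀ with det(M(b) − λ(b)·I) = 0 for all b in some neighbourhood of b₀. Set T(b) = tr M(b) and D(b) = det M(b). If |D'(b₀)| > |λ(b₀)| · |T'(b₀)|, then λ'(b₀) ≠ 0. -/

import Mathlib

open Filter Topology Matrix

/-- The characteristic equation of a 2×2 matrix in terms of trace and determinant. -/
theorem det_sub_smul_one_fin_two {R : Type*} [CommRing R] (A : Matrix (Fin 2) (Fin 2) R) (r : R) :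
    (A - r • (1 : Matrix (Fin 2) (Fin 2) R)).det = r ^ 2 - A.trace * r + A.det := by
  simp [det_fin_two, trace_fin_two]
  ring

/-- for a differentiable family of 2×2 matrices with a differentiable
eigenvalue branch `λ`, if `|D'(b₀)| > |λ(b₀)|·|T'(b₀)|` then `λ'(b₀) ≠ 0`. -/
theorem eigenvalue_deriv_ne_zero
    (M : ℝ → Matrix (Fin 2) (Fin 2) ℝ) (b₀ : ℝ)
    (hM : ∀ i j : Fin 2, DifferentiableAt ℝ (fun b => M b i j) b₀)
    (lam : ℝ → ℝ) (hlam : DifferentiableAt ℝ lam b₀)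
    (heig : ∀ᶠ b in 𝓝 b₀, (M b - lam b • (1 : Matrix (Fin 2) (Fin 2) ℝ)).det = 0)
    (hineq : |deriv (fun b => (M b).det) b₀| >
      |lam b₀| * |deriv (fun b => (M b).trace) b₀|) :
    deriv lam b₀ ≠ 0 := by
  intro h0
  have hT : DifferentiableAt ℝ (fun b => (M b).trace) b₀ := by
    simpa only [trace_fin_two] using (hM 0 0).fun_add (hM 1 1)
  have hD : DifferentiableAt ℝ (fun b => (M b).det) b₀ := by
    simpa only [det_fin_two] using
      ((hM 0 0).fun_mul (hM 1 1)).fun_sub ((hM 0 1).fun_mul (hM 1 0))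
  have hchar := ((hlam.hasDerivAt.fun_pow 2).fun_sub
    (hT.hasDerivAt.fun_mul hlam.hasDerivAt)).fun_add hD.hasDerivAt
  have hzero : (fun b => lam b ^ 2 - (M b).trace * lam b + (M b).det) =ᶠ[𝓝 b₀] fun _ => 0 :=
    heig.mono fun b hb => by rwa [det_sub_smul_one_fin_two] at hb
  have hderiv := hchar.unique ((hasDerivAt_const b₀ (0 : ℝ)).congr_of_eventuallyEq hzero)
  rw [h0] at hderiv
  have hDT : deriv (fun b => (M b).det) b₀ = lam b₀ * deriv (fun b => (M b).trace) b₀ := by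
    linarith
  rw [hDT, abs_mul] at hineq
  exact lt_irrefl _ hineq
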